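/- Let ν ∈ ℂ with Re(ν) > −1 and let f ∈ S_ν([0,∞)). Then for every y > 0, H_ν(Df)(y) = −D(H_ν(f))(y), where D is the operator (Df)(x) = x f′(x). -/

import Mathlib

open MeasureTheory Set

/-- The classical J-Bessel function of complex index `ν`, via its power series
(principal branch of powers). -/
noncomputable def besselJ (ν : ℂ) (x : ℝ) : ℂ :=
  ∑' k : ℕ, ((-1 : ℂ) ^ k * ((x / 2 : ℝ) : ℂ) ^ (ν + 2 * (k : ℂ))) /
    (Complex.Gamma ((k : ℂ) + 1) * Complex.Gamma ((k : ℂ) + ν + 1))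

/-- `g` and all of its derivatives are rapidly decreasing at `+∞`. -/
def RapidlyDecreasing (g : ℝ → ℂ) : Prop :=
  ∀ m n : ℕ, ∃ C : ℝ, ∀ x : ℝ, 1 ≤ x → x ^ m * ‖iteratedDeriv n g x‖ ≤ C

/-- Membership in the Schwartz space `S([0,∞))`: `f` agrees on `[0,∞)` with a smooth
function on `ℝ` all of whose derivatives are rapidly decreasing at `+∞`. -/
def MemSHalf (f : ℝ → ℂ) : Prop :=
  ∃ g : ℝ → ℂ, ContDiff ℝ (⊤ : ℕ∞) g ∧ (∀ x : ℝ, 0 ≤ x → f x = g x) ∧ RapidlyDecreasing g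

/-- Membership in `S_ν([0,∞))`: `f(x) = x^{(ν+1)/2} f₁(x)` on `[0,∞)` for some
`f₁ ∈ S([0,∞))` (principal branch of the complex power). -/
def MemSnu (ν : ℂ) (f : ℝ → ℂ) : Prop :=
  ∃ f₁ : ℝ → ℂ, MemSHalf f₁ ∧ ∀ x : ℝ, 0 ≤ x → f x = (x : ℂ) ^ ((ν + 1) / 2) * f₁ x

/-- The Hankel transform of order `ν`: `H_ν(f)(y) = ∫₀^∞ f(x) √(xy) J_ν(2√(xy)) dx/x`. -/
noncomputable def hankel (ν : ℂ) (f : ℝ → ℂ) (y : ℝ) : ℂ :=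
  ∫ x in Ioi (0 : ℝ), f x * (Real.sqrt (x * y) : ℂ) * besselJ ν (2 * Real.sqrt (x * y)) / (x : ℂ)

/-- The coefficients of the entire function `z ↦ z^{-ν/2} J_ν(2√z)`, up to sign. -/
noncomputable def besselCoeff (ν : ℂ) (k : ℕ) : ℂ :=
  1 / ((k.factorial : ℂ) * Complex.Gamma ((k : ℂ) + ν + 1))

/-- The entire function `z ↦ z^{-ν/2} J_ν(2√z)` on the real line. -/
noncomputable def besselEntire (ν : ℂ) (x : ℝ) : ℂ :=
  ∑' k : ℕ, besselCoeff ν k * (-(x : ℂ)) ^ k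

section BesselEntire

variable {ν : ℂ}

lemma natCast_add_add_one_re_pos (hν : -1 < ν.re) (k : ℕ) : 0 < ((k : ℂ) + ν + 1).re := by
  have : (0 : ℝ) ≤ k := k.cast_nonneg
  simp only [Complex.add_re, Complex.natCast_re, Complex.one_re]
  linarith

lemma exists_norm_inv_Gamma_le (hν : -1 < ν.re) :
    ∃ C : ℝ, ∀ k : ℕ, ‖(Complex.Gamma ((k : ℂ) + ν + 1))⁻¹‖ ≤ C := by
  have step (k : ℕ) : ‖(Complex.Gamma (((k + 1 + 1 : ℕ) : ℂ) + ν + 1))⁻¹‖ ≤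
      ‖(Complex.Gamma (((k + 1 : ℕ) : ℂ) + ν + 1))⁻¹‖ := by
    have hpos := natCast_add_add_one_re_pos hν (k + 1)
    have hne : ((k + 1 : ℕ) : ℂ) + ν + 1 ≠ 0 := fun h => by
      rw [h] at hpos; simp at hpos
    have harg : ((k + 1 + 1 : ℕ) : ℂ) + ν + 1 = (((k + 1 : ℕ) : ℂ) + ν + 1) + 1 := by
      push_cast; ring
    have hone : 1 ≤ ‖((k + 1 : ℕ) : ℂ) + ν + 1‖ := by
      refine le_trans ?_ (Complex.re_le_norm _)
      have : (0 : ℝ) ≤ k := k.cast_nonneg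
      simp only [Complex.add_re, Complex.natCast_re, Complex.one_re]
      push_cast
      linarith
    rw [harg, Complex.Gamma_add_one _ hne, mul_inv, norm_mul, norm_inv]
    exact mul_le_of_le_one_left (norm_nonneg _) (inv_le_one_of_one_le₀ hone)
  refine ⟨max ‖(Complex.Gamma (((0 : ℕ) : ℂ) + ν + 1))⁻¹‖
    ‖(Complex.Gamma (((0 + 1 : ℕ) : ℂ) + ν + 1))⁻¹‖, fun k => ?_⟩
  rcases k with _ | k
  · exact le_max_left _ _
  · exact ((antitone_nat_of_succ_le
      (f := fun k : ℕ => ‖(Complex.Gamma (((k + 1 : ℕ) : ℂ) + ν + 1))⁻¹‖) step)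
      (Nat.zero_le k)).trans (le_max_right _ _)

lemma exists_norm_besselCoeff_le (hν : -1 < ν.re) :
    ∃ C : ℝ, ∀ k : ℕ, ‖besselCoeff ν k‖ ≤ C / (k.factorial : ℝ) := by
  obtain ⟨C, hC⟩ := exists_norm_inv_Gamma_le hν
  refine ⟨C, fun k => ?_⟩
  have : besselCoeff ν k = (Complex.Gamma ((k : ℂ) + ν + 1))⁻¹ / (k.factorial : ℂ) := by
    rw [besselCoeff, one_div, mul_inv, div_eq_mul_inv, mul_comm]
  rw [this, norm_div, Complex.norm_natCast]
  gcongr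
  exact hC k

lemma succ_mul_besselCoeff_succ (ν : ℂ) (k : ℕ) :
    ((k : ℂ) + 1) * besselCoeff ν (k + 1) = besselCoeff (ν + 1) k := by
  have hk : ((k : ℂ) + 1) ≠ 0 := Nat.cast_add_one_ne_zero k
  have harg : ((k + 1 : ℕ) : ℂ) + ν + 1 = (k : ℂ) + (ν + 1) + 1 := by push_cast; ring
  rw [besselCoeff, besselCoeff, harg, Nat.factorial_succ, Nat.cast_mul, Nat.cast_succ,
    mul_one_div, mul_assoc, div_mul_eq_div_div, div_self hk]

lemma natCast_add_add_one_mul_besselCoeff (hν : -1 < ν.re) (k : ℕ) :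
    ((k : ℂ) + ν + 1) * besselCoeff (ν + 1) k = besselCoeff ν k := by
  have hpos := natCast_add_add_one_re_pos hν k
  have hne : (k : ℂ) + ν + 1 ≠ 0 := fun h => by simp [h] at hpos
  have hΓ := Complex.Gamma_ne_zero_of_re_pos hpos
  have hfac : (k.factorial : ℂ) ≠ 0 := Nat.cast_ne_zero.mpr k.factorial_ne_zero
  rw [besselCoeff, besselCoeff, ← add_assoc (k : ℂ) ν 1, Complex.Gamma_add_one _ hne]
  field_simp

lemma summable_besselEntire (hν : -1 < ν.re) (x : ℝ) :
    Summable fun k : ℕ => besselCoeff ν k * (-(x : ℂ)) ^ k := by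
  obtain ⟨C, hC⟩ := exists_norm_besselCoeff_le hν
  refine Summable.of_norm_bounded ((Real.summable_pow_div_factorial |x|).mul_left C) fun k => ?_
  rw [norm_mul, norm_pow, norm_neg, Complex.norm_real, Real.norm_eq_abs, mul_div_assoc', mul_comm C,
    mul_div_assoc, mul_comm]
  gcongr
  exact hC k

lemma hasDerivAt_besselEntire (hν : -1 < ν.re) (x : ℝ) :
    HasDerivAt (besselEntire ν) (-besselEntire (ν + 1) x) x := by
  have hν' : -1 < (ν + 1).re := by simp only [Complex.add_re, Complex.one_re]; linarith
  obtain ⟨C, hC⟩ := exists_norm_besselCoeff_le hν'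
  set R : ℝ := |x| + 1
  have hpow (k : ℕ) (y : ℝ) : HasDerivAt (fun y : ℝ => besselCoeff ν (k + 1) * (-(y : ℂ)) ^ (k + 1))
      (-(besselCoeff (ν + 1) k * (-(y : ℂ)) ^ k)) y := by
    have h := ((Complex.ofRealCLM.hasDerivAt (x := y)).neg.pow (k + 1)).const_mul
      (besselCoeff ν (k + 1))
    refine h.congr_deriv ?_
    rw [← succ_mul_besselCoeff_succ]
    simp
    ring
  have htail := hasDerivAt_tsum_of_isPreconnected
    (g := fun (k : ℕ) (y : ℝ) => besselCoeff ν (k + 1) * (-(y : ℂ)) ^ (k + 1))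
    (g' := fun (k : ℕ) (y : ℝ) => -(besselCoeff (ν + 1) k * (-(y : ℂ)) ^ k))
    (t := Metric.ball (0 : ℝ) R) (y₀ := x) (y := x)
    ((Real.summable_pow_div_factorial R).mul_left C) Metric.isOpen_ball
    (convex_ball _ _).isPreconnected (fun k y _ => hpow k y)
    (fun k y hy => by
      have hy' : |y| ≤ R := by simpa using (Metric.mem_ball.mp hy).le
      rw [norm_neg, norm_mul, norm_pow, norm_neg, Complex.norm_real, Real.norm_eq_abs,
        mul_div_assoc', mul_comm C, mul_div_assoc, mul_comm]
      gcongr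
      exact hC k)
    (by simp [R])
    ((summable_nat_add_iff (f := fun k : ℕ => besselCoeff ν k * (-(x : ℂ)) ^ k) 1).mpr
      (summable_besselEntire hν x))
    (by simp [R])
  rw [tsum_neg] at htail
  refine (htail.const_add (besselCoeff ν 0)).congr_of_eventuallyEq (.of_forall fun y => ?_)
  simp only [besselEntire]
  rw [(summable_besselEntire hν y).tsum_eq_zero_add, pow_zero, mul_one]

lemma continuous_besselEntire (hν : -1 < ν.re) : Continuous (besselEntire ν) :=
  continuous_iff_continuousAt.mpr fun x => (hasDerivAt_besselEntire hν x).continuousAt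

/-- The three-term recurrence, equivalent to Bessel's differential equation. -/
lemma mul_besselEntire_add_two (hν : -1 < ν.re) (x : ℝ) :
    (x : ℂ) * besselEntire (ν + 1 + 1) x =
      (ν + 1) * besselEntire (ν + 1) x - besselEntire ν x := by
  have hν₁ : -1 < (ν + 1).re := by simp only [Complex.add_re, Complex.one_re]; linarith
  have hν₂ : -1 < (ν + 1 + 1).re := by simp only [Complex.add_re, Complex.one_re]; linarith
  have hterm (k : ℕ) : (ν + 1) * (besselCoeff (ν + 1) k * (-(x : ℂ)) ^ k) -
      besselCoeff ν k * (-(x : ℂ)) ^ k = -((k : ℂ) * besselCoeff (ν + 1) k * (-(x : ℂ)) ^ k) := by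
    rw [← natCast_add_add_one_mul_besselCoeff hν k]
    ring
  have hs := ((summable_besselEntire hν₁ x).mul_left (ν + 1)).sub (summable_besselEntire hν x)
  rw [besselEntire, besselEntire, besselEntire, ← tsum_mul_left, ← tsum_mul_left,
    ← ((summable_besselEntire hν₁ x).mul_left (ν + 1)).tsum_sub (summable_besselEntire hν x),
    hs.tsum_eq_zero_add, hterm]
  simp only [Nat.cast_zero, zero_mul, neg_zero, zero_add]
  refine tsum_congr fun k => ?_
  rw [hterm, ← succ_mul_besselCoeff_succ]
  push_cast
  ring

/-- The energy `‖φ‖² + x ‖φ'‖²` of `φ = besselEntire ν`, whose growth controls that of `φ`. -/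
noncomputable def besselEnergy (ν : ℂ) (x : ℝ) : ℝ :=
  ‖besselEntire ν x‖ ^ 2 + x * ‖besselEntire (ν + 1) x‖ ^ 2

lemma hasDerivAt_besselEnergy (hν : -1 < ν.re) (x : ℝ) :
    HasDerivAt (besselEnergy ν) (-(2 * ν.re + 1) * ‖besselEntire (ν + 1) x‖ ^ 2) x := by
  have hν₁ : -1 < (ν + 1).re := by simp only [Complex.add_re, Complex.one_re]; linarith
  have h := (hasDerivAt_besselEntire hν x).norm_sq.add
    ((hasDerivAt_id x).mul (hasDerivAt_besselEntire hν₁ x).norm_sq)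
  refine h.congr_deriv ?_
  have hrec := mul_besselEntire_add_two hν x
  have hre := congrArg Complex.re hrec
  have him := congrArg Complex.im hrec
  simp only [Complex.mul_re, Complex.mul_im, Complex.sub_re, Complex.sub_im, Complex.add_re,
    Complex.add_im, Complex.ofReal_re, Complex.ofReal_im, Complex.one_re, Complex.one_im] at hre him
  simp only [Complex.inner, Complex.sq_norm, Complex.normSq_apply, Complex.mul_re, Complex.neg_re,
    Complex.neg_im, Complex.conj_re, Complex.conj_im, id]
  linear_combination (-2 * (besselEntire (ν + 1) x).re) * hre -
    2 * (besselEntire (ν + 1) x).im * him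

lemma exists_norm_besselEntire_le (hν : -1 < ν.re) :
    ∃ C : ℝ, ∀ x : ℝ, 0 ≤ x → ‖besselEntire ν x‖ ≤ C * (1 + x) := by
  obtain ⟨A, hA⟩ := (isCompact_Icc (a := (0 : ℝ)) (b := 1)).exists_bound_of_continuousOn
    (continuous_besselEntire hν).continuousOn
  have hder (x : ℝ) (hx : 0 < x) := (hasDerivAt_besselEnergy hν x).div (hasDerivAt_id x) hx.ne'
  have hanti : AntitoneOn (fun x => besselEnergy ν x / x) (Ici 1) := by
    refine antitoneOn_of_deriv_nonpos (convex_Ici 1)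
      (fun x hx => (hder x (zero_lt_one.trans_le hx)).continuousAt.continuousWithinAt)
      (fun x hx => ?_) (fun x hx => ?_)
    all_goals
      rw [interior_Ici, mem_Ioi] at hx
      have hx0 : 0 < x := zero_lt_one.trans hx
    · exact (hder x hx0).differentiableAt.differentiableWithinAt
    · refine (hder x hx0).deriv.le.trans (div_nonpos_of_nonpos_of_nonneg ?_ (sq_nonneg _))
      have h₀ : 0 ≤ ‖besselEntire ν x‖ ^ 2 := sq_nonneg _
      have h₁ : 0 ≤ (ν.re + 1) * (x * ‖besselEntire (ν + 1) x‖ ^ 2) :=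
        mul_nonneg (by linarith) (by positivity)
      simp only [besselEnergy, id]
      linarith
  set B := besselEnergy ν 1
  have hB : 0 ≤ B := by simp only [B, besselEnergy]; positivity
  have hA0 : 0 ≤ A := (norm_nonneg _).trans (hA 0 (by simp))
  refine ⟨A + (B + 1), fun x hx => ?_⟩
  rcases le_total x 1 with h1 | h1
  · have := hA x ⟨hx, h1⟩
    nlinarith
  · have hle : besselEnergy ν x / x ≤ B := by
      simpa using hanti (mem_Ici.mpr le_rfl) (mem_Ici.mpr h1) h1
    rw [div_le_iff₀ (by linarith)] at hle
    have hsq : ‖besselEntire ν x‖ ^ 2 ≤ B * x := by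
      refine le_trans ?_ hle
      have : 0 ≤ x * ‖besselEntire (ν + 1) x‖ ^ 2 := by positivity
      simp only [besselEnergy]
      linarith
    have : ‖besselEntire ν x‖ ≤ (B + 1) * (1 + x) := by
      refine le_of_sq_le_sq ?_ (by positivity)
      nlinarith [mul_nonneg hB hx, mul_nonneg hB hB, mul_nonneg (mul_nonneg hB hx) hB]
    nlinarith

end BesselEntire

section Kernel

variable {ν : ℂ}

lemma sqrt_mul_besselJ_two_sqrt (ν : ℂ) {z : ℝ} (hz : 0 < z) :
    (Real.sqrt z : ℂ) * besselJ ν (2 * Real.sqrt z) =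
      (Real.sqrt z : ℂ) ^ (ν + 1) * besselEntire ν z := by
  have hs : (Real.sqrt z : ℂ) ≠ 0 := Complex.ofReal_ne_zero.mpr (Real.sqrt_pos.mpr hz).ne'
  have hsq : (Real.sqrt z : ℂ) ^ 2 = z := by
    rw [← Complex.ofReal_pow, Real.sq_sqrt hz.le]
  rw [besselJ, besselEntire, Complex.cpow_add _ _ hs, Complex.cpow_one, mul_comm (_ ^ ν), mul_assoc]
  congr 1
  rw [← tsum_mul_left]
  refine tsum_congr fun k => ?_
  have hpow : (Real.sqrt z : ℂ) ^ (2 * (k : ℂ)) = (z : ℂ) ^ k := by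
    rw [← hsq, ← pow_mul, ← Complex.cpow_natCast]
    push_cast
    rfl
  rw [mul_div_cancel_left₀ _ (two_ne_zero' ℝ), Complex.cpow_add _ _ hs, hpow, besselCoeff,
    Complex.Gamma_nat_eq_factorial, neg_pow (z : ℂ)]
  ring

lemma continuousOn_sqrt_mul_besselJ (hν : -1 < ν.re) :
    ContinuousOn (fun z : ℝ => (Real.sqrt z : ℂ) * besselJ ν (2 * Real.sqrt z)) (Ioi 0) := by
  refine ContinuousOn.congr (f := fun z : ℝ => (Real.sqrt z : ℂ) ^ (ν + 1) * besselEntire ν z) ?_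
    fun z hz => sqrt_mul_besselJ_two_sqrt ν hz
  refine ContinuousOn.mul (ContinuousOn.cpow_const ?_ fun z hz => ?_)
    (continuous_besselEntire hν).continuousOn
  · exact (Complex.continuous_ofReal.comp Real.continuous_sqrt).continuousOn
  · exact Complex.ofReal_mem_slitPlane.mpr (Real.sqrt_pos.mpr hz)

lemma exists_norm_sqrt_mul_besselJ_le (hν : -1 < ν.re) :
    ∃ B : ℝ, ∀ z : ℝ, 0 < z → ‖(Real.sqrt z : ℂ) * besselJ ν (2 * Real.sqrt z)‖ ≤
      B * (z ^ ((ν.re + 1) / 2) * (1 + z)) := by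
  obtain ⟨C, hC⟩ := exists_norm_besselEntire_le hν
  refine ⟨C, fun z hz => ?_⟩
  rw [sqrt_mul_besselJ_two_sqrt ν hz, norm_mul,
    Complex.norm_cpow_eq_rpow_re_of_pos (Real.sqrt_pos.mpr hz), Real.sqrt_eq_rpow,
    ← Real.rpow_mul hz.le, Complex.add_re, Complex.one_re, one_div_mul_eq_div, mul_left_comm]
  gcongr
  exact hC z hz.le

/-- The Hankel transform as a multiplicative convolution against a fixed kernel. -/
lemma hankel_eq_integral_comp_div (ν : ℂ) (f : ℝ → ℂ) {y : ℝ} (hy : 0 < y) :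
    hankel ν f y = ∫ x in Ioi (0 : ℝ),
      f (x / y) * ((Real.sqrt x : ℂ) * besselJ ν (2 * Real.sqrt x)) / (x : ℂ) := by
  have hy' : (y : ℂ) ≠ 0 := Complex.ofReal_ne_zero.mpr hy.ne'
  have h := integral_comp_mul_left_Ioi' (fun x : ℝ =>
    f (x / y) * ((Real.sqrt x : ℂ) * besselJ ν (2 * Real.sqrt x)) / (x : ℂ)) 0 hy
  rw [mul_zero] at h
  rw [← h, hankel, ← integral_smul]
  refine integral_congr_ae (.of_forall fun x => ?_)
  simp only [mul_comm y x, mul_div_cancel_right₀ _ hy.ne', Complex.real_smul, Complex.ofReal_mul]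
  rw [mul_comm (x : ℂ), ← mul_div_assoc, mul_div_mul_left _ _ hy', mul_assoc]

end Kernel

section MultiplicativeConvolution

lemma integrableOn_rpow_div_one_add_pow {a : ℝ} (ha : 0 < a) {M : ℕ} (hM : a + 1 ≤ M) :
    IntegrableOn (fun x : ℝ => x ^ (a - 1) / (1 + x) ^ M) (Ioi 0) := by
  have hmeas : Measurable fun x : ℝ => x ^ (a - 1) / (1 + x) ^ M := by fun_prop
  rw [← Ioc_union_Ioi_eq_Ioi zero_le_one, integrableOn_union]
  constructor
  · have h : IntegrableOn (fun x : ℝ => x ^ (a - 1)) (Ioc 0 1) :=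
      (integrableOn_Ioc_iff_integrableOn_Ioo).mpr
        ((intervalIntegral.integrableOn_Ioo_rpow_iff zero_lt_one).mpr (by linarith))
    refine h.mono' hmeas.aestronglyMeasurable ?_
    filter_upwards [ae_restrict_mem measurableSet_Ioc] with x hx
    have hx0 : 0 < x := hx.1
    rw [Real.norm_of_nonneg (by positivity)]
    exact div_le_self (by positivity) (one_le_pow₀ (by linarith))
  · refine (integrableOn_Ioi_rpow_of_lt (a := -2) (by norm_num) zero_lt_one).mono'
      hmeas.aestronglyMeasurable ?_
    filter_upwards [ae_restrict_mem measurableSet_Ioi] with x hx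
    have hx1 : 1 < x := hx
    have hx0 : 0 < x := zero_lt_one.trans hx1
    rw [Real.norm_of_nonneg (by positivity)]
    calc x ^ (a - 1) / (1 + x) ^ M ≤ x ^ (a - 1) / x ^ M := by gcongr; linarith
      _ = x ^ (a - 1 - M) := by rw [Real.rpow_sub hx0 (a - 1), Real.rpow_natCast]
      _ ≤ x ^ (-2 : ℝ) := Real.rpow_le_rpow_of_exponent_le hx1.le (by linarith)

lemma norm_mul_div_le_of_dilation {b A B x y y₀ : ℝ} {M : ℕ} {w k : ℂ} (hb : 0 < b)
    (hx : 0 < x) (hy₀ : 0 < y₀) (hy : y ∈ Ioo (y₀ / 2) (2 * y₀))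
    (hw : ‖w‖ ≤ A * ((x / y) ^ b / (1 + x / y) ^ (M + 1)))
    (hk : ‖k‖ ≤ B * (x ^ b * (1 + x))) :
    ‖w * k / (x : ℂ)‖ ≤ A * B * (2 / y₀) ^ b * (1 + 2 * y₀) ^ (M + 1) *
      (x ^ (2 * b - 1) / (1 + x) ^ M) := by
  have hypos : 0 < y := by linarith [hy.1]
  have hA : 0 ≤ A := (mul_nonneg_iff_of_pos_right (by positivity)).mp ((norm_nonneg _).trans hw)
  have hB : 0 ≤ B := (mul_nonneg_iff_of_pos_right (by positivity)).mp ((norm_nonneg _).trans hk)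
  have hdil : x / y ≤ x * (2 / y₀) := by
    rw [div_le_iff₀ hypos, mul_assoc]
    refine le_mul_of_one_le_right hx.le ?_
    rw [div_mul_eq_mul_div, one_le_div hy₀]
    linarith [hy.1]
  have hone : 1 + x ≤ (1 + 2 * y₀) * (1 + x / y) := by
    have h1 : x = y * (x / y) := by field_simp
    have h2 : y * (x / y) ≤ 2 * y₀ * (x / y) := by gcongr; exact hy.2.le
    have h3 : 0 ≤ x / y := by positivity
    linarith
  have hden : 1 / (1 + x / y) ^ (M + 1) ≤ (1 + 2 * y₀) ^ (M + 1) / (1 + x) ^ (M + 1) := by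
    rw [div_le_div_iff₀ (by positivity) (by positivity), one_mul, ← mul_pow]
    gcongr
  have hnum : (x / y) ^ b ≤ x ^ b * (2 / y₀) ^ b := by
    rw [← Real.mul_rpow hx.le (by positivity)]
    gcongr
  rw [norm_div, norm_mul, Complex.norm_real, Real.norm_of_nonneg hx.le]
  calc ‖w‖ * ‖k‖ / x
      ≤ A * ((x / y) ^ b * (1 / (1 + x / y) ^ (M + 1))) * (B * (x ^ b * (1 + x))) / x := by
        rw [mul_one_div]
        gcongr
    _ ≤ A * (x ^ b * (2 / y₀) ^ b * ((1 + 2 * y₀) ^ (M + 1) / (1 + x) ^ (M + 1))) *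
        (B * (x ^ b * (1 + x))) / x := by gcongr
    _ = _ := by
        rw [Real.rpow_sub_one hx.ne', two_mul b, Real.rpow_add hx, pow_succ (1 + x)]
        field_simp

/-- Differentiation in the dilation parameter of a multiplicative convolution. -/
lemma hasDerivAt_integral_comp_div_mul {b A A' B : ℝ} {M : ℕ} (hb : 0 < b) (hM : 2 * b + 1 ≤ M)
    {f K : ℝ → ℂ} (hf : ∀ x, 0 < x → DifferentiableAt ℝ f x)
    (hfA : ∀ x : ℝ, 0 < x → ‖f x‖ ≤ A * (x ^ b / (1 + x) ^ (M + 1)))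
    (hfA' : ∀ x : ℝ, 0 < x → ‖(x : ℂ) * deriv f x‖ ≤ A' * (x ^ b / (1 + x) ^ (M + 1)))
    (hK : ContinuousOn K (Ioi 0)) (hKB : ∀ x : ℝ, 0 < x → ‖K x‖ ≤ B * (x ^ b * (1 + x)))
    {y₀ : ℝ} (hy₀ : 0 < y₀) :
    HasDerivAt (fun y => ∫ x in Ioi (0 : ℝ), f (x / y) * K x / (x : ℂ))
      (-(1 / (y₀ : ℂ)) * ∫ x in Ioi (0 : ℝ),
        ((x / y₀ : ℝ) : ℂ) * deriv f (x / y₀) * K x / (x : ℂ)) y₀ := by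
  have hmem : y₀ ∈ Ioo (y₀ / 2) (2 * y₀) := ⟨by linarith, by linarith⟩
  have hcont {y : ℝ} (hy : 0 < y) : ContinuousOn (fun x => f (x / y) * K x / (x : ℂ)) (Ioi 0) := by
    refine ContinuousOn.div (ContinuousOn.mul (fun x hx => ?_) hK)
      Complex.continuous_ofReal.continuousOn fun x hx => Complex.ofReal_ne_zero.mpr (ne_of_gt hx)
    exact ((hf (x / y) (div_pos hx hy)).continuousAt.comp (f := fun x : ℝ => x / y)
      (by fun_prop)).continuousWithinAt
  have hKm : AEStronglyMeasurable K (volume.restrict (Ioi 0)) :=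
    hK.aestronglyMeasurable measurableSet_Ioi
  have hbound := integrableOn_rpow_div_one_add_pow (a := 2 * b) (by linarith) hM
  rw [← integral_const_mul]
  refine (hasDerivAt_integral_of_dominated_loc_of_deriv_le
    (F := fun y x => f (x / y) * K x / (x : ℂ))
    (F' := fun y x => -(1 / (y : ℂ)) * (((x / y : ℝ) : ℂ) * deriv f (x / y) * K x / (x : ℂ)))
    (bound := fun x => 2 / y₀ * (A' * B * (2 / y₀) ^ b * (1 + 2 * y₀) ^ (M + 1) *
      (x ^ (2 * b - 1) / (1 + x) ^ M)))
    (Ioo_mem_nhds hmem.1 hmem.2) ?_ ?_ ?_ ?_ ?_ ?_).2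
  · filter_upwards [lt_mem_nhds hy₀] with y hy
    exact (hcont hy).aestronglyMeasurable measurableSet_Ioi
  · refine Integrable.mono' (hbound.const_mul (A * B * (2 / y₀) ^ b * (1 + 2 * y₀) ^ (M + 1)))
      ((hcont hy₀).aestronglyMeasurable measurableSet_Ioi) ?_
    filter_upwards [ae_restrict_mem measurableSet_Ioi] with x hx
    exact norm_mul_div_le_of_dilation hb hx hy₀ hmem (hfA _ (div_pos hx hy₀)) (hKB x hx)
  · have hd : Measurable fun x : ℝ => deriv f (x / y₀) :=
      (measurable_deriv f).comp (measurable_id.div_const y₀)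
    have hx : Measurable fun x : ℝ => ((x / y₀ : ℝ) : ℂ) := by fun_prop
    simp only [div_eq_mul_inv _ (Complex.ofReal _)]
    exact ((((hx.mul hd).aestronglyMeasurable).mul hKm).mul
      Complex.measurable_ofReal.inv.aestronglyMeasurable).const_mul _
  · filter_upwards [ae_restrict_mem measurableSet_Ioi] with x hx y hy
    have hypos : 0 < y := by linarith [hy.1]
    rw [norm_mul]
    refine mul_le_mul ?_ (norm_mul_div_le_of_dilation hb hx hy₀ hy (hfA' _ (div_pos hx hypos))
      (hKB x hx)) (norm_nonneg _) (by positivity)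
    rw [norm_neg, norm_div, norm_one, Complex.norm_real, Real.norm_of_nonneg hypos.le,
      div_le_div_iff₀ hypos hy₀]
    linarith [hy.1]
  · exact (hbound.const_mul _).const_mul _
  · filter_upwards [ae_restrict_mem measurableSet_Ioi] with x hx y hy
    have hypos : 0 < y := by linarith [hy.1]
    have hx' : (x : ℂ) ≠ 0 := Complex.ofReal_ne_zero.mpr (ne_of_gt hx)
    have hy' : (y : ℂ) ≠ 0 := Complex.ofReal_ne_zero.mpr hypos.ne'
    have hdiv : HasDerivAt (fun y : ℝ => x / y) (-x / y ^ 2) y := by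
      refine ((hasDerivAt_const y x).div (hasDerivAt_id y) hypos.ne').congr_deriv ?_
      simp
    have h := (((hf _ (div_pos hx hypos)).hasDerivAt.scomp y hdiv).mul_const (K x)).div_const (x : ℂ)
    refine h.congr_deriv ?_
    rw [Complex.real_smul]
    push_cast
    field_simp

end MultiplicativeConvolution

section SchwartzHalfLine

lemma RapidlyDecreasing.exists_one_add_pow_mul_norm_iteratedDeriv_le {g : ℝ → ℂ}
    (hr : RapidlyDecreasing g) (hg : ContDiff ℝ (⊤ : ℕ∞) g) (N n : ℕ) :
    ∃ C : ℝ, 0 ≤ C ∧ ∀ x : ℝ, 0 ≤ x → ‖iteratedDeriv n g x‖ ≤ C / (1 + x) ^ N := by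
  have hcont : Continuous (iteratedDeriv n g) :=
    hg.continuous_iteratedDeriv n (by exact_mod_cast le_top)
  obtain ⟨A, hA⟩ := (isCompact_Icc (a := (0 : ℝ)) (b := 1)).exists_bound_of_continuousOn
    hcont.continuousOn
  obtain ⟨B, hB⟩ := hr N n
  refine ⟨2 ^ N * max A B, ?_, fun x hx => ?_⟩
  · exact mul_nonneg (by positivity)
      (le_max_of_le_left ((norm_nonneg _).trans (hA 0 (by simp))))
  rw [le_div_iff₀ (by positivity), mul_comm]
  rcases le_total x 1 with h1 | h1
  · have h2 : (1 + x) ^ N ≤ 2 ^ N := by gcongr; linarith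
    exact mul_le_mul h2 ((hA x ⟨hx, h1⟩).trans (le_max_left _ _)) (norm_nonneg _) (by positivity)
  · have h2 : (1 + x) ^ N ≤ 2 ^ N * x ^ N := by rw [← mul_pow]; gcongr; linarith
    calc (1 + x) ^ N * ‖iteratedDeriv n g x‖ ≤ 2 ^ N * x ^ N * ‖iteratedDeriv n g x‖ := by gcongr
      _ = 2 ^ N * (x ^ N * ‖iteratedDeriv n g x‖) := mul_assoc _ _ _
      _ ≤ 2 ^ N * max A B := by gcongr; exact (hB x h1).trans (le_max_right _ _)

variable {ν : ℂ} {f : ℝ → ℂ}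

lemma MemSnu.exists_hasDerivAt (hν : -1 < ν.re) (hf : MemSnu ν f) :
    ∃ g : ℝ → ℂ, ContDiff ℝ (⊤ : ℕ∞) g ∧ RapidlyDecreasing g ∧ ∀ x : ℝ, 0 < x →
      f x = (x : ℂ) ^ ((ν + 1) / 2) * g x ∧
      HasDerivAt f ((x : ℂ) ^ ((ν + 1) / 2) * ((ν + 1) / 2 * g x / x + deriv g x)) x := by
  obtain ⟨f₁, ⟨g, hg, hfg, hr⟩, hff₁⟩ := hf
  have heq (x : ℝ) (hx : 0 < x) : f x = (x : ℂ) ^ ((ν + 1) / 2) * g x := by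
    rw [hff₁ x hx.le, hfg x hx.le]
  refine ⟨g, hg, hr, fun x hx => ⟨heq x hx, ?_⟩⟩
  have hx' : (x : ℂ) ≠ 0 := Complex.ofReal_ne_zero.mpr hx.ne'
  have hμ : (ν + 1) / 2 ≠ 0 := by
    refine div_ne_zero (fun h => ?_) two_ne_zero
    have := congrArg Complex.re h
    simp only [Complex.add_re, Complex.one_re, Complex.zero_re] at this
    linarith
  have hdg : HasDerivAt g (deriv g x) x :=
    (hg.differentiable (by simp) x).hasDerivAt
  have h := (hasDerivAt_ofReal_cpow_const hx.ne' hμ).mul hdg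
  refine (h.congr_of_eventuallyEq ?_).congr_deriv ?_
  · filter_upwards [lt_mem_nhds hx] with z hz using heq z hz
  · rw [Complex.cpow_sub _ _ hx', Complex.cpow_one]
    field_simp

lemma MemSnu.exists_norm_le (hν : -1 < ν.re) (hf : MemSnu ν f) (N : ℕ) :
    ∃ A : ℝ, ∀ x : ℝ, 0 < x → ‖f x‖ ≤ A * (x ^ ((ν.re + 1) / 2) / (1 + x) ^ N) := by
  obtain ⟨g, hg, hr, hfg⟩ := hf.exists_hasDerivAt hν
  obtain ⟨C, -, hC⟩ := hr.exists_one_add_pow_mul_norm_iteratedDeriv_le hg N 0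
  refine ⟨C, fun x hx => ?_⟩
  have := hC x hx.le
  rw [iteratedDeriv_zero] at this
  rw [(hfg x hx).1, norm_mul, Complex.norm_cpow_eq_rpow_re_of_pos hx, mul_div_left_comm]
  simp only [Complex.div_ofNat_re, Complex.add_re, Complex.one_re]
  gcongr

lemma MemSnu.exists_norm_mul_deriv_le (hν : -1 < ν.re) (hf : MemSnu ν f) (N : ℕ) :
    ∃ A : ℝ, ∀ x : ℝ, 0 < x →
      ‖(x : ℂ) * deriv f x‖ ≤ A * (x ^ ((ν.re + 1) / 2) / (1 + x) ^ N) := by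
  obtain ⟨g, hg, hr, hfg⟩ := hf.exists_hasDerivAt hν
  obtain ⟨C₀, -, hC₀⟩ := hr.exists_one_add_pow_mul_norm_iteratedDeriv_le hg N 0
  obtain ⟨C₁, hC₁0, hC₁⟩ := hr.exists_one_add_pow_mul_norm_iteratedDeriv_le hg (N + 1) 1
  refine ⟨‖(ν + 1) / 2‖ * C₀ + C₁, fun x hx => ?_⟩
  have h₀ := hC₀ x hx.le
  have h₁ := hC₁ x hx.le
  rw [iteratedDeriv_zero] at h₀
  rw [iteratedDeriv_one] at h₁
  have hx' : (x : ℂ) ≠ 0 := Complex.ofReal_ne_zero.mpr hx.ne'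
  have hD : (x : ℂ) * deriv f x =
      (x : ℂ) ^ ((ν + 1) / 2) * ((ν + 1) / 2 * g x + x * deriv g x) := by
    rw [(hfg x hx).2.deriv]
    field_simp
  rw [hD, norm_mul, Complex.norm_cpow_eq_rpow_re_of_pos hx, mul_div_left_comm]
  simp only [Complex.div_ofNat_re, Complex.add_re, Complex.one_re]
  gcongr
  calc ‖(ν + 1) / 2 * g x + x * deriv g x‖ ≤ ‖(ν + 1) / 2 * g x‖ + ‖x * deriv g x‖ :=
        norm_add_le _ _
    _ = ‖(ν + 1) / 2‖ * ‖g x‖ + x * ‖deriv g x‖ := by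
        rw [norm_mul, norm_mul, Complex.norm_real, Real.norm_of_nonneg hx.le]
    _ ≤ ‖(ν + 1) / 2‖ * (C₀ / (1 + x) ^ N) + (1 + x) * (C₁ / (1 + x) ^ (N + 1)) := by
        gcongr
        linarith
    _ = (‖(ν + 1) / 2‖ * C₀ + C₁) / (1 + x) ^ N := by
        have : (1 + x) ≠ 0 := by positivity
        rw [pow_succ]
        field_simp

end SchwartzHalfLine

/-- `H_ν(Df)(y) = -D(H_ν(f))(y)` for `f ∈ S_ν([0,∞))`, `Re ν > -1`,
where `(Df)(x) = x f'(x)`. -/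
theorem hankel_intertwines_D (ν : ℂ) (hν : -1 < ν.re) (f : ℝ → ℂ) (hf : MemSnu ν f) :
    ∀ y : ℝ, 0 < y →
      hankel ν (fun x => (x : ℂ) * deriv f x) y = -((y : ℂ) * deriv (fun t => hankel ν f t) y) := by
  intro y hy
  obtain ⟨M, hM⟩ := exists_nat_ge (2 * ((ν.re + 1) / 2) + 1)
  obtain ⟨A, hA⟩ := hf.exists_norm_le hν (M + 1)
  obtain ⟨A', hA'⟩ := hf.exists_norm_mul_deriv_le hν (M + 1)
  obtain ⟨B, hB⟩ := exists_norm_sqrt_mul_besselJ_le hν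
  have hdiff (x : ℝ) (hx : 0 < x) : DifferentiableAt ℝ f x := by
    obtain ⟨g, -, -, hfg⟩ := hf.exists_hasDerivAt hν
    exact (hfg x hx).2.differentiableAt
  have hderiv := hasDerivAt_integral_comp_div_mul (by linarith) hM hdiff hA hA'
    (continuousOn_sqrt_mul_besselJ hν) hB hy
  have hev : (fun t => hankel ν f t) =ᶠ[nhds y] fun t => ∫ x in Ioi (0 : ℝ),
      f (x / t) * ((Real.sqrt x : ℂ) * besselJ ν (2 * Real.sqrt x)) / (x : ℂ) := by
    filter_upwards [lt_mem_nhds hy] with t ht using hankel_eq_integral_comp_div ν f ht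
  have hy' : (y : ℂ) ≠ 0 := Complex.ofReal_ne_zero.mpr hy.ne'
  rw [hev.deriv_eq, hderiv.deriv, hankel_eq_integral_comp_div ν _ hy, neg_mul, mul_neg, neg_neg,
    ← mul_assoc, mul_one_div_cancel hy', one_mul]
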